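/- arXiv:2006.05260 — 9 statements merged into one kernel-verified Lean document; each statement's English description precedes it below -/
import Mathlib

section
/- Let t ≥ 0, x > 0, ξ > 0 and π ∈ ℝ, and let W_t be a Gaussian random variable with mean 0 and variance t on a probability space (Ω, 𝓕, ℙ). Define the consumption at time t of the constant proportional strategy by C_t = ξ·x·exp(πσW_t + (r + λσπ − ξ − π²σ²/2)t). Then E[e^{−δt} · C_t^{1−R}/(1−R)] = (x^{1−R} ξ^{1−R}/(1−R)) · e^{−F(π,ξ)t}. -/
open MeasureTheory ProbabilityTheory Filter Set

/-- Expected discounted utility of consumption at a single time `t` under a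
constant proportional strategy. -/
theorem merton_single_time_expected_utility
    (r μ δ σ R : ℝ) (hσ : 0 < σ) (hR : 0 < R) (hR1 : R ≠ 1)
    (lam : ℝ) (hlam : lam = (μ - r) / σ)
    (F : ℝ → ℝ → ℝ)
    (hF : ∀ p ξ : ℝ, F p ξ = δ - (1 - R) * (r + lam * σ * p - p ^ 2 * σ ^ 2 * R / 2 - ξ))
    (t : ℝ) (ht : 0 ≤ t) (x ξ p : ℝ) (hx : 0 < x) (hξ : 0 < ξ)
    {Ω : Type*} [MeasurableSpace Ω] (P : Measure Ω) [IsProbabilityMeasure P]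
    (W : Ω → ℝ) (hW : P.map W = gaussianReal 0 t.toNNReal)
    (C : Ω → ℝ)
    (hC : ∀ ω, C ω
      = ξ * x * Real.exp (p * σ * W ω + (r + lam * σ * p - ξ - p ^ 2 * σ ^ 2 / 2) * t)) :
    ∫ ω, Real.exp (-δ * t) * (C ω) ^ (1 - R) / (1 - R) ∂P
      = x ^ (1 - R) * ξ ^ (1 - R) / (1 - R) * Real.exp (-(F p ξ) * t) := by
  set k := (r + lam * σ * p - ξ - p ^ 2 * σ ^ 2 / 2) * t
  have hmgf := mgf_gaussianReal hW ((1 - R) * (p * σ))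
  rw [mgf, Real.coe_toNNReal t ht] at hmgf
  have hint : ∀ ω, Real.exp (-δ * t) * (C ω) ^ (1 - R) / (1 - R)
      = x ^ (1 - R) * ξ ^ (1 - R) / (1 - R) * Real.exp (-δ * t + (1 - R) * k)
        * Real.exp ((1 - R) * (p * σ) * W ω) := by
    intro ω
    have hexp : (p * σ * W ω + k) * (1 - R) = (1 - R) * k + (1 - R) * (p * σ) * W ω := by ring
    rw [hC, Real.mul_rpow (mul_pos hξ hx).le (Real.exp_pos _).le, Real.mul_rpow hξ.le hx.le,
      ← Real.exp_mul, hexp, Real.exp_add, Real.exp_add]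
    ring
  simp_rw [hint]
  rw [integral_const_mul, hmgf, mul_assoc, ← Real.exp_add, hF]
  congr 2
  simp only [k]
  ring
end

section
/- Let (Ω, 𝓕, ℙ) be a probability space carrying a jointly measurable stochastic process W = (W_t)_{t≥0} such that for each t ≥ 0 the random variable W_t is Gaussian with mean 0 and variance t (e.g. a standard Brownian motion). Fix x > 0, ξ > 0, π ∈ ℝ and set C_t = ξ·x·exp(πσW_t + (r + λσπ − ξ − π²σ²/2)t). If F(π, ξ) > 0, then E[∫_0^∞ e^{−δt} C_t^{1−R}/(1−R) dt] = x^{1−R} ξ^{1−R} / ((1−R) F(π,ξ)). -/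
open MeasureTheory ProbabilityTheory Filter Set

/-- If `X` has a Gaussian law, then `exp (a * X)` is integrable. -/
lemma integrable_exp_mul_of_map_eq_gaussianReal {Ω : Type*} [MeasurableSpace Ω] {P : Measure Ω}
    {X : Ω → ℝ} (hX : Measurable X) {m : ℝ} {v : NNReal} (hXv : P.map X = gaussianReal m v)
    (a : ℝ) : Integrable (fun ω ↦ Real.exp (a * X ω)) P := by
  have h := integrable_exp_mul_gaussianReal (μ := m) (v := v) a
  rw [← hXv] at h
  exact h.comp_measurable hX

/-- The expectation of `exp (a * X + b * t)` when `X` has law `N(0, t)`. -/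
lemma integral_exp_mul_add_of_map_eq_gaussianReal {Ω : Type*} [MeasurableSpace Ω] {P : Measure Ω}
    {X : Ω → ℝ} {t : ℝ} (ht : 0 ≤ t) (hX : P.map X = gaussianReal 0 t.toNNReal) (a b : ℝ) :
    ∫ ω, Real.exp (a * X ω + b * t) ∂P = Real.exp ((b + a ^ 2 / 2) * t) := by
  have h := mgf_gaussianReal hX a
  rw [mgf] at h
  simp_rw [Real.exp_add]
  rw [integral_mul_const, h, ← Real.exp_add, Real.coe_toNNReal t ht]
  ring_nf

/-- The expectation of the time integral of `exp (a * W t + b * t)` for a jointly measurable process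
with Gaussian marginals `N(0, t)`. -/
lemma integral_integral_exp_of_map_eq_gaussianReal {Ω : Type*} [MeasurableSpace Ω] (P : Measure Ω)
    [IsProbabilityMeasure P] (W : ℝ → Ω → ℝ) (hWmeas : Measurable (Function.uncurry W))
    (hW : ∀ t : ℝ, 0 ≤ t → P.map (W t) = gaussianReal 0 t.toNNReal)
    {a b : ℝ} (hab : b + a ^ 2 / 2 < 0) :
    ∫ ω, (∫ t in Set.Ioi (0 : ℝ), Real.exp (a * W t ω + b * t)) ∂P = -(b + a ^ 2 / 2)⁻¹ := by
  have hmeas : Measurable fun z : Ω × ℝ ↦ Real.exp (a * W z.2 z.1 + b * z.2) := by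
    have : Measurable fun z : Ω × ℝ ↦ W z.2 z.1 := hWmeas.comp measurable_swap
    fun_prop
  have hfi : Integrable (Function.uncurry fun ω t ↦ Real.exp (a * W t ω + b * t))
      (P.prod (volume.restrict (Set.Ioi (0 : ℝ)))) := by
    refine (integrable_prod_iff' hmeas.aestronglyMeasurable).2 ⟨?_, ?_⟩
    · filter_upwards [ae_restrict_mem measurableSet_Ioi] with t ht
      have hWt : Measurable (W t) := hWmeas.of_uncurry_left
      simp only [Real.exp_add]
      exact (integrable_exp_mul_of_map_eq_gaussianReal hWt (hW t (le_of_lt ht)) a).mul_const _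
    · refine (integrableOn_exp_mul_Ioi hab 0).congr ?_
      filter_upwards [ae_restrict_mem measurableSet_Ioi] with t ht
      simp only [Real.norm_eq_abs, Real.abs_exp]
      exact (integral_exp_mul_add_of_map_eq_gaussianReal (le_of_lt ht) (hW t (le_of_lt ht)) a b).symm
  rw [integral_integral_swap hfi, setIntegral_congr_fun measurableSet_Ioi fun t ht ↦
    integral_exp_mul_add_of_map_eq_gaussianReal (le_of_lt ht) (hW t (le_of_lt ht)) a b,
    integral_exp_mul_Ioi hab 0]
  simp [neg_div]

/-- Expected integrated discounted utility of a constant proportional strategy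
when `F(π, ξ) > 0`. -/
theorem merton_constant_proportional_value
    (r μ δ σ R : ℝ) (hσ : 0 < σ) (hR : 0 < R) (hR1 : R ≠ 1)
    (lam : ℝ) (hlam : lam = (μ - r) / σ)
    (F : ℝ → ℝ → ℝ)
    (hF : ∀ p ξ : ℝ, F p ξ = δ - (1 - R) * (r + lam * σ * p - p ^ 2 * σ ^ 2 * R / 2 - ξ))
    {Ω : Type*} [MeasurableSpace Ω] (P : Measure Ω) [IsProbabilityMeasure P]
    (W : ℝ → Ω → ℝ) (hWmeas : Measurable (Function.uncurry W))
    (hW : ∀ t : ℝ, 0 ≤ t → P.map (W t) = gaussianReal 0 t.toNNReal)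
    (x ξ p : ℝ) (hx : 0 < x) (hξ : 0 < ξ)
    (C : ℝ → Ω → ℝ)
    (hC : ∀ t ω, C t ω
      = ξ * x * Real.exp (p * σ * W t ω + (r + lam * σ * p - ξ - p ^ 2 * σ ^ 2 / 2) * t))
    (hFpos : 0 < F p ξ) :
    ∫ ω, (∫ t in Set.Ioi (0 : ℝ), Real.exp (-δ * t) * (C t ω) ^ (1 - R) / (1 - R)) ∂P
      = x ^ (1 - R) * ξ ^ (1 - R) / ((1 - R) * F p ξ) := by
  have hR0 : 1 - R ≠ 0 := sub_ne_zero.2 hR1.symm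
  set a := (1 - R) * (p * σ) with ha
  set b := (1 - R) * (r + lam * σ * p - ξ - p ^ 2 * σ ^ 2 / 2) - δ with hb
  have hab : b + a ^ 2 / 2 = -F p ξ := by
    rw [hF, ha, hb]
    ring
  have hutil : ∀ t ω, Real.exp (-δ * t) * (C t ω) ^ (1 - R) / (1 - R)
      = x ^ (1 - R) * ξ ^ (1 - R) / (1 - R) * Real.exp (a * W t ω + b * t) := by
    intro t ω
    rw [hC, Real.mul_rpow (by positivity) (Real.exp_nonneg _), Real.mul_rpow hξ.le hx.le,
      ← Real.exp_mul]
    have hexp : Real.exp (a * W t ω + b * t) = Real.exp (-δ * t) * Real.exp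
        ((p * σ * W t ω + (r + lam * σ * p - ξ - p ^ 2 * σ ^ 2 / 2) * t) * (1 - R)) := by
      rw [← Real.exp_add, ha, hb]
      ring_nf
    rw [hexp]
    ring
  simp_rw [hutil, integral_const_mul]
  rw [integral_integral_exp_of_map_eq_gaussianReal P W hWmeas hW (by linarith), hab]
  field_simp
end

section
/- Suppose η > 0. Then F(λ/(σR), η) = η > 0, and for every π ∈ ℝ and ξ > 0 with F(π, ξ) > 0 one has ξ^{1−R}/((1−R)·F(π,ξ)) ≤ η^{−R}/(1−R), with equality if and only if π = λ/(σR) and ξ = η. In other words, over the region {(π, ξ) : ξ > 0, F(π,ξ) > 0}, the function (π, ξ) ↦ ξ^{1−R}/((1−R)F(π,ξ)) attains its maximum value η^{−R}/(1−R) uniquely at (λ/(σR), η). -/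
/-- A strict form of Bernoulli's inequality `1 + a * (y - 1) < y ^ a` for `a > 1`, reversed for
`0 < a < 1`, with both cases expressed through the sign of `1 - a`. -/
theorem one_sub_mul_bernoulli_gap_pos {a y : ℝ} (ha : 0 < a) (ha1 : a ≠ 1) (hy : 0 < y)
    (hy1 : y ≠ 1) : 0 < (1 - a) * (1 + a * (y - 1) - y ^ a) := by
  have hs : -1 ≤ y - 1 := by linarith
  have hs0 : y - 1 ≠ 0 := sub_ne_zero.mpr hy1
  have hadd : 1 + (y - 1) = y := by ring
  rcases lt_or_gt_of_ne ha1 with h | h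
  · have hb := rpow_one_add_lt_one_add_mul_self hs hs0 ha h
    rw [hadd] at hb
    exact mul_pos (by linarith) (by linarith)
  · have hb := one_add_mul_self_lt_rpow_one_add hs hs0 h
    rw [hadd] at hb
    exact mul_pos_of_neg_of_neg (by linarith) (by linarith)

/-- Strict weighted arithmetic-geometric mean inequality with weights `a` and `1 - a`, valid for
all `a > 0`, `a ≠ 1`. -/
theorem one_sub_mul_weighted_mean_gap_pos {a x y : ℝ} (ha : 0 < a) (ha1 : a ≠ 1) (hx : 0 < x)
    (hy : 0 < y) (hxy : x ≠ y) :
    0 < (1 - a) * (a * y + (1 - a) * x - y ^ a * x ^ (1 - a)) := by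
  have hratio : y / x ≠ 1 := fun h => hxy ((div_eq_one_iff_eq hx.ne').mp h).symm
  have hb := mul_pos hx (one_sub_mul_bernoulli_gap_pos ha ha1 (div_pos hy hx) hratio)
  have hpow : y ^ a * x ^ (1 - a) = x * (y / x) ^ a := by
    rw [Real.div_rpow hy.le hx.le, Real.rpow_sub hx, Real.rpow_one]
    ring
  have hlin : x * (1 + a * (y / x - 1)) = a * y + (1 - a) * x := by
    field_simp
    ring
  rw [hpow, ← hlin]
  linarith

/-- When `η > 0`, the map `(π, ξ) ↦ ξ^{1−R}/((1−R) F(π,ξ))` on the region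
`{ξ > 0, F(π,ξ) > 0}` attains its maximum `η^{−R}/(1−R)` uniquely at `(λ/(σR), η)`. -/
theorem merton_static_optimum
    (r μ δ σ R : ℝ) (hσ : 0 < σ) (hR : 0 < R) (hR1 : R ≠ 1)
    (lam : ℝ) (hlam : lam = (μ - r) / σ)
    (F : ℝ → ℝ → ℝ)
    (hF : ∀ p ξ : ℝ, F p ξ = δ - (1 - R) * (r + lam * σ * p - p ^ 2 * σ ^ 2 * R / 2 - ξ))
    (η : ℝ) (hηdef : η = (1 / R) * (δ - (1 - R) * (r + lam ^ 2 / (2 * R))))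
    (hη : 0 < η) :
    F (lam / (σ * R)) η = η ∧ 0 < F (lam / (σ * R)) η ∧
      ∀ p ξ : ℝ, 0 < ξ → 0 < F p ξ →
        (ξ ^ (1 - R) / ((1 - R) * F p ξ) ≤ η ^ (-R) / (1 - R) ∧
          (ξ ^ (1 - R) / ((1 - R) * F p ξ) = η ^ (-R) / (1 - R) ↔
            p = lam / (σ * R) ∧ ξ = η)) := by
  have hRne : R ≠ 0 := hR.ne'
  have hσne : σ ≠ 0 := hσ.ne'
  have h1R : 1 - R ≠ 0 := sub_ne_zero.mpr hR1.symm
  have hFsq : ∀ p ξ : ℝ, F p ξ = R * η + (1 - R) * ξ +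
      (1 - R) * (R * σ ^ 2 / 2 * (p - lam / (σ * R)) ^ 2) := by
    intro p ξ
    rw [hF, hηdef]
    field_simp
    ring
  have hFopt : F (lam / (σ * R)) η = η := by
    rw [hFsq]
    ring
  refine ⟨hFopt, hFopt.symm ▸ hη, fun p ξ hξ hFpos => ?_⟩
  have hpow : η ^ R * η ^ (-R) = 1 := by
    rw [← Real.rpow_add hη, add_neg_cancel, Real.rpow_zero]
  have hposη : 0 < η ^ (-R) := Real.rpow_pos_of_pos hη _
  have hdiff : η ^ (-R) / (1 - R) - ξ ^ (1 - R) / ((1 - R) * F p ξ) =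
      η ^ (-R) / ((1 - R) ^ 2 * F p ξ) * ((1 - R) * (F p ξ - η ^ R * ξ ^ (1 - R))) := by
    have hFne := hFpos.ne'
    field_simp
    linear_combination ξ ^ (1 - R) * hpow
  have hcoef : 0 < η ^ (-R) / ((1 - R) ^ 2 * F p ξ) := by positivity
  have hgap : (1 - R) * (F p ξ - η ^ R * ξ ^ (1 - R)) =
      (1 - R) * (R * η + (1 - R) * ξ - η ^ R * ξ ^ (1 - R)) +
        (1 - R) ^ 2 * (R * σ ^ 2 / 2 * (p - lam / (σ * R)) ^ 2) := by
    rw [hFsq]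
    ring
  have hsq : 0 ≤ (1 - R) ^ 2 * (R * σ ^ 2 / 2 * (p - lam / (σ * R)) ^ 2) := by positivity
  have hopt : η ^ (1 - R) / ((1 - R) * η) = η ^ (-R) / (1 - R) := by
    rw [sub_eq_neg_add, Real.rpow_add hη, Real.rpow_one, mul_div_mul_right _ _ hη.ne']
  by_cases hopteq : p = lam / (σ * R) ∧ ξ = η
  · obtain ⟨rfl, rfl⟩ := hopteq
    rw [hFopt, hopt]
    simp
  · have hpos : 0 < (1 - R) * (F p ξ - η ^ R * ξ ^ (1 - R)) := by
      rw [hgap]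
      by_cases hξη : ξ = η
      · have hp : p - lam / (σ * R) ≠ 0 := sub_ne_zero.mpr fun h => hopteq ⟨h, hξη⟩
        have hmean : η ^ R * η ^ (1 - R) = η := by
          rw [← Real.rpow_add hη, add_sub_cancel, Real.rpow_one]
        have hzero : (1 - R) * (R * η + (1 - R) * η - η ^ R * η ^ (1 - R)) = 0 := by
          rw [hmean]
          ring
        rw [hξη, hzero, zero_add]
        positivity
      · linarith [one_sub_mul_weighted_mean_gap_pos hR hR1 hξ hη hξη]
    have hlt : ξ ^ (1 - R) / ((1 - R) * F p ξ) < η ^ (-R) / (1 - R) := by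
      rw [← sub_pos, hdiff]
      exact mul_pos hcoef hpos
    exact ⟨hlt.le, fun h => absurd h hlt.ne, fun h => absurd h hopteq⟩
end

section
/- Suppose R < 1 and η ≤ 0. Then the function (π, ξ) ↦ ξ^{1−R}/((1−R)·F(π,ξ)) is unbounded above on the region {(π, ξ) : ξ > 0, F(π,ξ) > 0}; indeed, already along π = λ/(σR) one has F(λ/(σR), ξ) ↓ 0 as ξ ↓ −ηR/(1−R), and sup{ ξ^{1−R}/((1−R)F(λ/(σR),ξ)) : ξ > 0, F(λ/(σR),ξ) > 0 } = +∞. -/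
open Filter Set

/-- For `0 < R < 1`, the quotient `t ^ (1 - R) / ((1 - R) ^ 2 * t)` takes arbitrarily large values
at positive `t`. -/
lemma exists_pos_lt_rpow_div_sq_mul {R : ℝ} (hR : 0 < R) (hR1 : R < 1) (M : ℝ) :
    ∃ t : ℝ, 0 < t ∧ M < t ^ (1 - R) / ((1 - R) ^ 2 * t) := by
  have hc : 0 < 1 - R := sub_pos.mpr hR1
  obtain ⟨s, hs, hMs⟩ : ∃ s : ℝ, 0 < s ∧ M < s :=
    ⟨|M| + 1, by positivity, (le_abs_self M).trans_lt (lt_add_one _)⟩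
  have ht : 0 < s ^ (-1 / R) := Real.rpow_pos_of_pos hs _
  have hpow : (s ^ (-1 / R)) ^ (1 - R) = s * s ^ (-1 / R) := by
    rw [← Real.rpow_mul hs.le, ← Real.rpow_one_add' hs.le]
    · congr 1
      field_simp
      ring
    · intro h
      field_simp at h
      linarith
  refine ⟨s ^ (-1 / R), ht, ?_⟩
  rw [hpow, mul_div_mul_right _ _ ht.ne']
  exact hMs.trans_le (le_div_self hs.le (by positivity) (pow_le_one₀ hc.le (by linarith)))

/-- If `R < 1` and `η ≤ 0`, the objective is unbounded above on the region
`{ξ > 0, F(π,ξ) > 0}`; indeed `F(λ/(σR), ξ) ↓ 0` as `ξ ↓ −ηR/(1−R)` and the supremum along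
`π = λ/(σR)` is `+∞`. -/
theorem merton_ill_posed_R_lt_one
    (r μ δ σ R : ℝ) (hσ : 0 < σ) (hR : 0 < R) (hR1 : R < 1)
    (lam : ℝ) (hlam : lam = (μ - r) / σ)
    (F : ℝ → ℝ → ℝ)
    (hF : ∀ p ξ : ℝ, F p ξ = δ - (1 - R) * (r + lam * σ * p - p ^ 2 * σ ^ 2 * R / 2 - ξ))
    (η : ℝ) (hηdef : η = (1 / R) * (δ - (1 - R) * (r + lam ^ 2 / (2 * R))))
    (hη : η ≤ 0) :
    ¬ BddAbove {v : ℝ | ∃ p ξ : ℝ, 0 < ξ ∧ 0 < F p ξ ∧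
        v = ξ ^ (1 - R) / ((1 - R) * F p ξ)} ∧
      Tendsto (fun ξ : ℝ => F (lam / (σ * R)) ξ)
        (nhdsWithin (-η * R / (1 - R)) (Set.Ioi (-η * R / (1 - R)))) (nhds 0) ∧
      ¬ BddAbove {v : ℝ | ∃ ξ : ℝ, 0 < ξ ∧ 0 < F (lam / (σ * R)) ξ ∧
        v = ξ ^ (1 - R) / ((1 - R) * F (lam / (σ * R)) ξ)} := by
  have hc : 0 < 1 - R := sub_pos.mpr hR1
  have hFlin : ∀ ξ, F (lam / (σ * R)) ξ = (1 - R) * (ξ - -η * R / (1 - R)) := by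
    intro ξ
    rw [hF, hηdef]
    field_simp
    ring
  have hξ₀ : 0 ≤ -η * R / (1 - R) := by
    have : 0 ≤ -η := neg_nonneg.mpr hη
    positivity
  have hline : ¬ BddAbove {v : ℝ | ∃ ξ : ℝ, 0 < ξ ∧ 0 < F (lam / (σ * R)) ξ ∧
      v = ξ ^ (1 - R) / ((1 - R) * F (lam / (σ * R)) ξ)} := by
    simp only [hFlin]
    generalize -η * R / (1 - R) = ξ₀ at hξ₀ ⊢
    rw [not_bddAbove_iff]
    intro M
    obtain ⟨t, ht, hM⟩ := exists_pos_lt_rpow_div_sq_mul hR hR1 M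
    refine ⟨_, ⟨ξ₀ + t, by positivity, ?_, rfl⟩, hM.trans_le ?_⟩
    · rw [add_sub_cancel_left]
      positivity
    · rw [add_sub_cancel_left, ← mul_assoc, ← sq]
      gcongr
      linarith
  refine ⟨fun h => hline (h.mono ?_), ?_, hline⟩
  · rintro v ⟨ξ, hξ⟩
    exact ⟨_, ξ, hξ⟩
  · simp only [hFlin]
    refine tendsto_nhdsWithin_of_tendsto_nhds (Continuous.tendsto' (by fun_prop) _ _ ?_)
    simp
end

section
/- Suppose η > 0 and let V̂(x) = η^{−R} x^{1−R}/(1−R), so that V̂'(x) = η^{−R} x^{−R} and V̂''(x) = −R η^{−R} x^{−R−1}. Then V̂ solves the Hamilton–Jacobi–Bellman equation: for every x > 0, sup over π ∈ ℝ and c ≥ 0 of L(π, c; x, V̂) equals 0, and moreover L(π, c; x, V̂) ≤ 0 for all π ∈ ℝ, c ≥ 0 with equality at π = λ/(σR) and c = η·x. -/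
/-- Bernoulli's inequality for the CRRA utility: it lies below its tangent at `1`. -/
theorem crra_le_tangent_one {R t : ℝ} (hR : 0 < R) (hR1 : R ≠ 1) (ht : 0 ≤ t)
    (h : ¬(t = 0 ∧ 1 < R)) : t ^ (1 - R) / (1 - R) ≤ 1 / (1 - R) + (t - 1) := by
  rcases lt_or_gt_of_ne hR1 with h1 | h1
  · have hp : 0 < 1 - R := by linarith
    have hb := rpow_one_add_le_one_add_mul_self (s := t - 1) (by linarith)
      hp.le (by linarith)
    rw [add_sub_cancel] at hb
    rw [div_le_iff₀ hp, add_mul, div_mul_cancel₀ _ hp.ne']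
    linarith
  · have hp : 1 - R < 0 := by linarith
    have ht0 : 0 < t := lt_of_le_of_ne ht fun h0 => h ⟨h0.symm, h1⟩
    have hl := Real.log_le_sub_one_of_pos ht0
    have he := Real.add_one_le_exp (Real.log t * (1 - R))
    rw [← Real.rpow_def_of_pos ht0] at he
    rw [div_le_iff_of_neg hp, add_mul, div_mul_cancel₀ _ hp.ne]
    nlinarith

/-- The CRRA utility lies below its tangent at any `y > 0`. -/
theorem crra_le_tangent {R c y : ℝ} (hR : 0 < R) (hR1 : R ≠ 1) (hc : 0 ≤ c) (hy : 0 < y)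
    (h : ¬(c = 0 ∧ 1 < R)) :
    c ^ (1 - R) / (1 - R) ≤ y ^ (1 - R) / (1 - R) + y ^ (-R) * (c - y) := by
  have hb := crra_le_tangent_one hR hR1 (t := c / y) (by positivity)
    (fun h0 => h ⟨(div_eq_zero_iff.mp h0.1).resolve_right hy.ne', h0.2⟩)
  have hyp : 0 < y ^ (1 - R) := Real.rpow_pos_of_pos hy _
  have hyR : y ^ (1 - R) = y * y ^ (-R) := by
    rw [sub_eq_add_neg, Real.rpow_add hy, Real.rpow_one]
  rw [Real.div_rpow hc hy.le] at hb
  calc c ^ (1 - R) / (1 - R)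
      = y ^ (1 - R) * (c ^ (1 - R) / y ^ (1 - R) / (1 - R)) := by
        field_simp
    _ ≤ y ^ (1 - R) * (1 / (1 - R) + (c / y - 1)) := by gcongr
    _ = y ^ (1 - R) / (1 - R) + y ^ (-R) * (c - y) := by
        rw [mul_add, mul_one_div, hyR]
        congr 1
        field_simp

/-- The non-utility part of the HJB operator at `η ^ (-R) * x ^ (1 - R) / (1 - R)`, with the
square completed in the portfolio variable `p`. -/
theorem merton_drift_eq {r δ σ R lam η x : ℝ} (hR : 0 < R) (hR1 : R ≠ 1)
    (hη_def : η = (1 / R) * (δ - (1 - R) * (r + lam ^ 2 / (2 * R)))) (hη : 0 < η)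
    (hx : 0 < x) (p c : ℝ) :
    (-δ) * (η ^ (-R) * x ^ (1 - R) / (1 - R))
        + (x * (r + σ * lam * p) - c) * (η ^ (-R) * x ^ (-R))
        + (1 / 2) * σ ^ 2 * p ^ 2 * x ^ 2 * (-(R * η ^ (-R) * x ^ (-R - 1)))
      = -((η * x) ^ (1 - R) / (1 - R) + (η * x) ^ (-R) * (c - η * x))
        - (η * x) ^ (-R) * x * (lam - σ * R * p) ^ 2 / (2 * R) := by
  have hp : 1 - R ≠ 0 := sub_ne_zero.mpr hR1.symm
  have hδ : δ = R * η + (1 - R) * (r + lam ^ 2 / (2 * R)) := by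
    rw [hη_def]; field_simp; ring
  have h1 : ∀ y : ℝ, 0 < y → y ^ (1 - R) = y * y ^ (-R) := fun y hy => by
    rw [sub_eq_add_neg, Real.rpow_add hy, Real.rpow_one]
  have h2 : x ^ (-R - 1) = x ^ (-R) / x := by
    rw [Real.rpow_sub hx, Real.rpow_one]
  rw [h1 _ (mul_pos hη hx), h1 x hx, h2, Real.mul_rpow hη.le hx.le, hδ]
  generalize η ^ (-R) = a
  generalize x ^ (-R) = b
  field_simp
  ring


/-- The candidate value function `V̂(x) = η^{−R}x^{1−R}/(1−R)` solves the HJB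
equation: for every `x > 0` the supremum of `L(π, c; x, V̂)` over `π ∈ ℝ`, `c ≥ 0` is `0`,
attained at `π = λ/(σR)`, `c = ηx`.  The utility term uses the convention `0^{1−R} = ∞` for
`R > 1`, so the operator is `EReal`-valued. -/
theorem merton_HJB_candidate
    (r μ δ σ R : ℝ) (hσ : 0 < σ) (hR : 0 < R) (hR1 : R ≠ 1)
    (lam : ℝ) (hlam : lam = (μ - r) / σ)
    (η : ℝ) (hηdef : η = (1 / R) * (δ - (1 - R) * (r + lam ^ 2 / (2 * R))))
    (hη : 0 < η)
    (L : ℝ → ℝ → ℝ → EReal)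
    (hL : ∀ p c x : ℝ, L p c x
      = (if c = 0 ∧ 1 < R then (⊥ : EReal) else ((c ^ (1 - R) / (1 - R) : ℝ) : EReal))
        + (((-δ) * (η ^ (-R) * x ^ (1 - R) / (1 - R))
            + (x * (r + σ * lam * p) - c) * (η ^ (-R) * x ^ (-R))
            + (1 / 2) * σ ^ 2 * p ^ 2 * x ^ 2 * (-(R * η ^ (-R) * x ^ (-R - 1))) : ℝ)
          : EReal)) :
    ∀ x : ℝ, 0 < x →
      IsGreatest {v : EReal | ∃ p c : ℝ, 0 ≤ c ∧ v = L p c x} (0 : EReal) ∧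
        L (lam / (σ * R)) (η * x) x = (0 : EReal) := by
  intro x hx
  have hy : 0 < η * x := mul_pos hη hx
  have hopt : L (lam / (σ * R)) (η * x) x = (0 : EReal) := by
    rw [hL, if_neg (fun h => hy.ne' h.1), merton_drift_eq hR hR1 hηdef hη hx, ← EReal.coe_add,
      ← EReal.coe_zero]
    congr 1
    have h0 : lam - σ * R * (lam / (σ * R)) = 0 := by field_simp; ring
    rw [h0]
    ring
  refine ⟨⟨⟨_, _, hy.le, hopt.symm⟩, ?_⟩, hopt⟩
  rintro v ⟨p, c, hc, rfl⟩
  rw [hL]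
  split_ifs with h
  · rw [EReal.bot_add]
    exact bot_le
  · rw [merton_drift_eq hR hR1 hηdef hη hx, ← EReal.coe_add, ← EReal.coe_zero,
      EReal.coe_le_coe_iff]
    have ht := crra_le_tangent hR hR1 hc hy h
    have hs : 0 ≤ (η * x) ^ (-R) * x * (lam - σ * R * p) ^ 2 / (2 * R) := by positivity
    linarith
end

section
/- Let t ≥ 0 and let W_t be a Gaussian random variable with mean 0 and variance t on a probability space (Ω, 𝓕, ℙ). Suppose η > 0, set π̂ = λ/(σR), and for x > 0 let X̂_t = x·exp(π̂σW_t + (r + λσπ̂ − η − π̂²σ²/2)t). Then E[e^{−δt} X̂_t^{1−R}/(1−R)] = (x^{1−R}/(1−R))·e^{−ηt}; in particular the candidate optimal strategy satisfies the transversality condition lim_{t→∞} E[e^{−δt} X̂_t^{1−R}/(1−R)] = 0. -/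
open MeasureTheory ProbabilityTheory Filter Set

/-- For the candidate optimal wealth process,
`E[e^{−δt} X̂_t^{1−R}/(1−R)] = (x^{1−R}/(1−R)) e^{−ηt}`, and in particular the transversality
condition `lim_{t→∞} E[e^{−δt} X̂_t^{1−R}/(1−R)] = 0` holds. -/
theorem merton_candidate_transversality
    (r μ δ σ R : ℝ) (hσ : 0 < σ) (hR : 0 < R) (hR1 : R ≠ 1)
    (lam : ℝ) (hlam : lam = (μ - r) / σ)
    (η : ℝ) (hηdef : η = (1 / R) * (δ - (1 - R) * (r + lam ^ 2 / (2 * R))))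
    (hη : 0 < η)
    (phat : ℝ) (hphat : phat = lam / (σ * R))
    {Ω : Type*} [MeasurableSpace Ω] (P : Measure Ω) [IsProbabilityMeasure P]
    (W : ℝ → Ω → ℝ)
    (hW : ∀ t : ℝ, 0 ≤ t → P.map (W t) = gaussianReal 0 t.toNNReal)
    (x : ℝ) (hx : 0 < x)
    (X : ℝ → Ω → ℝ)
    (hX : ∀ t ω, X t ω
      = x * Real.exp (phat * σ * W t ω + (r + lam * σ * phat - η - phat ^ 2 * σ ^ 2 / 2) * t)) :
    (∀ t : ℝ, 0 ≤ t →
        ∫ ω, Real.exp (-δ * t) * (X t ω) ^ (1 - R) / (1 - R) ∂P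
          = x ^ (1 - R) / (1 - R) * Real.exp (-η * t)) ∧
      Tendsto (fun t : ℝ => ∫ ω, Real.exp (-δ * t) * (X t ω) ^ (1 - R) / (1 - R) ∂P)
        atTop (nhds 0) := by
  have hRne : R ≠ 0 := hR.ne'
  have hps : phat * σ = lam / R := by
    rw [hphat]
    field_simp
  have hδ : δ = R * η + (1 - R) * (r + lam ^ 2 / (2 * R)) := by
    rw [hηdef]
    field_simp
    ring
  have key : ∀ t : ℝ, 0 ≤ t →
      ∫ ω, Real.exp (-δ * t) * (X t ω) ^ (1 - R) / (1 - R) ∂P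
        = x ^ (1 - R) / (1 - R) * Real.exp (-η * t) := by
    intro t ht
    set c := r + lam * σ * phat - η - phat ^ 2 * σ ^ 2 / 2 with hc
    have hc' : c = r + lam * (lam / R) - η - (lam / R) ^ 2 / 2 := by
      rw [hc, ← hps]
      ring
    have hint : ∀ ω, Real.exp (-δ * t) * (X t ω) ^ (1 - R) / (1 - R)
        = x ^ (1 - R) / (1 - R) * Real.exp (-δ * t + (1 - R) * c * t)
          * Real.exp ((1 - R) * (lam / R) * W t ω) := by
      intro ω
      rw [hX, Real.mul_rpow hx.le (Real.exp_pos _).le, ← Real.exp_mul, hps, mul_assoc (_ / _),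
        ← Real.exp_add, mul_left_comm, ← Real.exp_add, mul_div_right_comm]
      ring_nf
    have hmgf : ∫ ω, Real.exp ((1 - R) * (lam / R) * W t ω) ∂P
        = Real.exp (t * ((1 - R) * (lam / R)) ^ 2 / 2) := by
      simpa [mgf, Real.coe_toNNReal t ht] using
        mgf_gaussianReal (hW t ht) ((1 - R) * (lam / R))
    simp_rw [hint]
    rw [integral_const_mul, hmgf, mul_assoc, ← Real.exp_add]
    congr 2
    rw [hδ, hc']
    field_simp
    ring
  refine ⟨key, ?_⟩
  have hexp : Tendsto (fun t : ℝ => Real.exp (-η * t)) atTop (nhds 0) :=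
    Real.tendsto_exp_atBot.comp (tendsto_id.const_mul_atTop_of_neg (neg_neg_of_pos hη))
  have hlim := hexp.const_mul (x ^ (1 - R) / (1 - R))
  rw [mul_zero] at hlim
  refine hlim.congr' ?_
  filter_upwards [eventually_ge_atTop 0] with t ht
  exact (key t ht).symm
end

section
/- Suppose R > 1, η > 0 and ξ > ηR/(R−1), and set π̂ = λ/(σR). Then F(π̂, ξ) < 0, and for a family (W_t)_{t≥0} where each W_t is a Gaussian random variable with mean 0 and variance t, the wealth process X_t = x·exp(π̂σW_t + (r + λσπ̂ − ξ − π̂²σ²/2)t) of the constant proportional strategy (π̂, ξ) with x > 0 satisfies lim_{t→∞} E[e^{−δt} X_t^{1−R}/(1−R)] = −∞; i.e. the transversality condition fails for this constant proportional strategy. -/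
open MeasureTheory ProbabilityTheory Filter Set

/-- Expected discounted power utility of a lognormal wealth `x e^{aW + bt}`, `W ~ N(0, t)`. -/
lemma integral_discounted_power_utility {Ω : Type*} [MeasurableSpace Ω] {P : Measure Ω}
    [IsProbabilityMeasure P] {W : Ω → ℝ} {t : ℝ} (ht : 0 ≤ t)
    (hW : P.map W = gaussianReal 0 t.toNNReal) {x : ℝ} (hx : 0 < x) (a b δ R : ℝ) :
    ∫ ω, Real.exp (-δ * t) * (x * Real.exp (a * W ω + b * t)) ^ (1 - R) / (1 - R) ∂P
      = x ^ (1 - R) / (1 - R)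
        * Real.exp ((-δ + (1 - R) * b + ((1 - R) * a) ^ 2 / 2) * t) := by
  have hmgf := mgf_gaussianReal hW ((1 - R) * a)
  rw [mgf, Real.coe_toNNReal t ht] at hmgf
  have hintegrand (ω : Ω) :
      Real.exp (-δ * t) * (x * Real.exp (a * W ω + b * t)) ^ (1 - R) / (1 - R)
        = x ^ (1 - R) / (1 - R) * Real.exp (-δ * t + (1 - R) * b * t)
          * Real.exp ((1 - R) * a * W ω) := by
    rw [Real.mul_rpow hx.le (Real.exp_pos _).le, ← Real.exp_mul,
      show (a * W ω + b * t) * (1 - R) = (1 - R) * b * t + (1 - R) * a * W ω by ring,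
      Real.exp_add, Real.exp_add]
    ring
  simp_rw [hintegrand]
  rw [integral_const_mul, hmgf, mul_assoc, ← Real.exp_add]
  congr 2
  ring

/-- If `R > 1`, `η > 0` and `ξ > ηR/(R−1)`, then `F(π̂, ξ) < 0` and the
transversality condition fails for the constant proportional strategy `(π̂, ξ)`:
`E[e^{−δt} X_t^{1−R}/(1−R)] → −∞` as `t → ∞`. -/
theorem merton_transversality_fails
    (r μ δ σ R : ℝ) (hσ : 0 < σ) (hR : 0 < R) (hR1 : 1 < R)
    (lam : ℝ) (hlam : lam = (μ - r) / σ)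
    (F : ℝ → ℝ → ℝ)
    (hF : ∀ p ξ : ℝ, F p ξ = δ - (1 - R) * (r + lam * σ * p - p ^ 2 * σ ^ 2 * R / 2 - ξ))
    (η : ℝ) (hηdef : η = (1 / R) * (δ - (1 - R) * (r + lam ^ 2 / (2 * R))))
    (hη : 0 < η)
    (phat : ℝ) (hphat : phat = lam / (σ * R))
    (ξ : ℝ) (hξ : η * R / (R - 1) < ξ)
    {Ω : Type*} [MeasurableSpace Ω] (P : Measure Ω) [IsProbabilityMeasure P]
    (W : ℝ → Ω → ℝ)
    (hW : ∀ t : ℝ, 0 ≤ t → P.map (W t) = gaussianReal 0 t.toNNReal)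
    (x : ℝ) (hx : 0 < x)
    (X : ℝ → Ω → ℝ)
    (hX : ∀ t ω, X t ω
      = x * Real.exp (phat * σ * W t ω + (r + lam * σ * phat - ξ - phat ^ 2 * σ ^ 2 / 2) * t)) :
    F phat ξ < 0 ∧
      Tendsto (fun t : ℝ => ∫ ω, Real.exp (-δ * t) * (X t ω) ^ (1 - R) / (1 - R) ∂P)
        atTop atBot := by
  have hR1' : 0 < R - 1 := by linarith
  have hFeq : F phat ξ = η * R - (R - 1) * ξ := by
    rw [hF, hηdef, hphat]
    field_simp
    ring
  have hFneg : F phat ξ < 0 := by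
    rw [div_lt_iff₀ hR1'] at hξ
    rw [hFeq]
    linarith
  refine ⟨hFneg, ?_⟩
  have hlim : Tendsto (fun t : ℝ => x ^ (1 - R) / (1 - R) * Real.exp (-F phat ξ * t))
      atTop atBot :=
    (Real.tendsto_exp_atTop.comp
      (tendsto_id.const_mul_atTop (neg_pos.2 hFneg))).const_mul_atTop_of_neg
      (div_neg_of_pos_of_neg (Real.rpow_pos_of_pos hx _) (by linarith))
  refine hlim.congr' ?_
  filter_upwards [eventually_ge_atTop 0] with t ht
  simp_rw [hX]
  rw [integral_discounted_power_utility ht (hW t ht) hx, hF]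
  congr 2
  ring
end

section
/- Suppose η > 0 and let V̂(x) = η^{−R} x^{1−R}/(1−R). Fix ε > 0, x > 0, y > 0 and set z = x + εy. Then the supremum over π ∈ ℝ and c ≥ 0 of the perturbed operator L^ε(π, c; x, y, V̂) = (c + εηy)^{1−R}/(1−R) − δ·V̂(z) + [x(r + πσλ) − c + (r + λ²/R − η)εy]·V̂'(z) + (1/2)(σπx + λεy/R)²·V̂''(z) equals 0, and the supremum is attained at π = λ/(σR) and c = η·x. -/
/-- Tangent-line inequality at `1` for the power utility `t ↦ t ^ (1 - R) / (1 - R)`. -/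
theorem rpow_one_sub_div_le_tangent_one {R t : ℝ} (hR : 0 < R) (hR1 : R ≠ 1) (ht : 0 < t) :
    t ^ (1 - R) / (1 - R) ≤ 1 / (1 - R) + (t - 1) := by
  rcases lt_or_gt_of_ne hR1 with h | h
  · have hp : 0 < 1 - R := by linarith
    have key := rpow_one_add_le_one_add_mul_self (s := t - 1) (p := 1 - R)
      (by linarith) hp.le (by linarith)
    rw [add_sub_cancel] at key
    rw [div_le_iff₀ hp, add_mul, one_div_mul_cancel hp.ne']
    linarith
  · have hp : 1 - R < 0 := by linarith
    have key : 1 + (1 - R) * (t - 1) ≤ t ^ (1 - R) := by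
      rw [Real.rpow_def_of_pos ht]
      have h₁ := Real.add_one_le_exp (Real.log t * (1 - R))
      have h₂ := Real.log_le_sub_one_of_pos ht
      nlinarith
    rw [div_le_iff_of_neg hp, add_mul, one_div_mul_cancel hp.ne]
    linarith

/-- Tangent-line inequality at `a` for the power utility `c ↦ c ^ (1 - R) / (1 - R)`. -/
theorem rpow_one_sub_div_le_tangent {R a c : ℝ} (hR : 0 < R) (hR1 : R ≠ 1)
    (ha : 0 < a) (hc : 0 < c) :
    c ^ (1 - R) / (1 - R) ≤ a ^ (1 - R) / (1 - R) + a ^ (-R) * (c - a) := by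
  have key := mul_le_mul_of_nonneg_left
    (rpow_one_sub_div_le_tangent_one hR hR1 (div_pos hc ha)) (Real.rpow_pos_of_pos ha (1 - R)).le
  have hca : c ^ (1 - R) = a ^ (1 - R) * (c / a) ^ (1 - R) := by
    rw [← Real.mul_rpow ha.le (div_pos hc ha).le, mul_div_cancel₀ _ ha.ne']
  have hslope : a ^ (-R) * (c - a) = a ^ (1 - R) * (c / a - 1) := by
    rw [show 1 - R = -R + 1 by ring, Real.rpow_add_one ha.ne']
    field_simp
  calc c ^ (1 - R) / (1 - R) = a ^ (1 - R) * ((c / a) ^ (1 - R) / (1 - R)) := by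
        rw [hca, mul_div_assoc]
    _ ≤ a ^ (1 - R) * (1 / (1 - R) + (c / a - 1)) := key
    _ = a ^ (1 - R) / (1 - R) + a ^ (-R) * (c - a) := by rw [hslope]; ring

/-- For `η > 0`, the supremum over `π ∈ ℝ`, `c ≥ 0` of the perturbed operator
`L^ε(π, c; x, y, V̂)` is `0`, attained at `π = λ/(σR)`, `c = ηx`. -/
theorem merton_perturbed_HJB
    (r μ δ σ R : ℝ) (hσ : 0 < σ) (hR : 0 < R) (hR1 : R ≠ 1)
    (lam : ℝ) (hlam : lam = (μ - r) / σ)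
    (η : ℝ) (hηdef : η = (1 / R) * (δ - (1 - R) * (r + lam ^ 2 / (2 * R))))
    (hη : 0 < η)
    (ε x y : ℝ) (hε : 0 < ε) (hx : 0 < x) (hy : 0 < y)
    (z : ℝ) (hz : z = x + ε * y)
    (Leps : ℝ → ℝ → ℝ)
    (hLeps : ∀ p c : ℝ, Leps p c
      = (c + ε * η * y) ^ (1 - R) / (1 - R) - δ * (η ^ (-R) * z ^ (1 - R) / (1 - R))
        + (x * (r + p * σ * lam) - c + (r + lam ^ 2 / R - η) * ε * y) * (η ^ (-R) * z ^ (-R))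
        + (1 / 2) * (σ * p * x + lam * ε * y / R) ^ 2 * (-(R * η ^ (-R) * z ^ (-R - 1)))) :
    IsGreatest {w : ℝ | ∃ p c : ℝ, 0 ≤ c ∧ w = Leps p c} 0 ∧
      Leps (lam / (σ * R)) (η * x) = 0 := by
  have hzpos : 0 < z := by rw [hz]; positivity
  have hηz : 0 < η * z := mul_pos hη hzpos
  have hRsub : 1 - R ≠ 0 := sub_ne_zero.mpr hR1.symm
  have hz₁ : z ^ (-R) = z ^ (-R - 1) * z := by
    rw [← Real.rpow_add_one hzpos.ne', sub_add_cancel]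
  have hz₂ : z ^ (1 - R) = z ^ (-R - 1) * z * z := by
    rw [← hz₁, ← Real.rpow_add_one hzpos.ne', neg_add_eq_sub]
  have hη₁ : η ^ (1 - R) = η ^ (-R) * η := by
    rw [← Real.rpow_add_one hη.ne', neg_add_eq_sub]
  have hδ : δ = R * η + (1 - R) * (r + lam ^ 2 / (2 * R)) := by
    rw [hηdef]; field_simp; ring
  have hdecomp : ∀ p c : ℝ, Leps p c =
      ((c + ε * η * y) ^ (1 - R) / (1 - R)
        - ((η * z) ^ (1 - R) / (1 - R) + (η * z) ^ (-R) * (c + ε * η * y - η * z)))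
      - R / 2 * (η ^ (-R) * z ^ (-R - 1))
        * (σ * p * x + lam * ε * y / R - lam * z / R) ^ 2 := by
    intro p c
    rw [hLeps, Real.mul_rpow hη.le hzpos.le, Real.mul_rpow hη.le hzpos.le, hz₂, hz₁, hη₁, hδ]
    generalize (c + ε * η * y) ^ (1 - R) = u
    generalize η ^ (-R) = a
    generalize z ^ (-R - 1) = b
    clear hηdef hδ
    subst hz
    field_simp
    ring
  have hopt : Leps (lam / (σ * R)) (η * x) = 0 := by
    have hc : η * x + ε * η * y = η * z := by rw [hz]; ring
    have hp : σ * (lam / (σ * R)) * x + lam * ε * y / R - lam * z / R = 0 := by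
      rw [hz]; field_simp; ring
    rw [hdecomp, hc, hp]
    ring
  refine ⟨⟨⟨lam / (σ * R), η * x, by positivity, hopt.symm⟩, ?_⟩, hopt⟩
  rintro _ ⟨p, c, hc, rfl⟩
  have hutil := rpow_one_sub_div_le_tangent hR hR1 hηz
    (show 0 < c + ε * η * y by positivity)
  have hquad : 0 ≤ R / 2 * (η ^ (-R) * z ^ (-R - 1))
      * (σ * p * x + lam * ε * y / R - lam * z / R) ^ 2 := by positivity
  rw [hdecomp]
  linarith
end

section
/- Suppose η > 0 and, for ζ > 0, define the shifted candidate value function V̂^ζ(x) = V̂(x + ζ) = η^{−R}(x+ζ)^{1−R}/(1−R) for x > 0. Then for every x > 0, the supremum over π ∈ ℝ and c ≥ 0 of L(π, c; x, V̂^ζ) equals −r·ζ·η^{−R}(x+ζ)^{−R}. In particular, if r ≥ 0 then L(π, c; x, V̂^ζ) ≤ 0 for all π ∈ ℝ and c ≥ 0. -/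
/-- Tangent line bound for the CRRA utility at `1`. -/
theorem rpow_one_sub_div_sub_le {R t : ℝ} (hR : 0 < R) (hR1 : R ≠ 1) (ht : 0 ≤ t)
    (htR : 1 < R → t ≠ 0) : t ^ (1 - R) / (1 - R) ≤ t + R / (1 - R) := by
  have key : t + R / (1 - R) = (1 + (1 - R) * (t - 1)) / (1 - R) := by
    have : 1 - R ≠ 0 := sub_ne_zero.mpr hR1.symm
    field_simp
    ring
  rw [key]
  rcases lt_or_gt_of_ne hR1 with h | h
  · refine div_le_div_of_nonneg_right ?_ (by linarith)
    have := rpow_one_add_le_one_add_mul_self (s := t - 1) (by linarith)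
      (p := 1 - R) (by linarith) (by linarith)
    simpa using this
  · refine div_le_div_of_nonpos_of_le (by linarith) ?_
    have ht0 : 0 < t := lt_of_le_of_ne ht (htR h).symm
    rw [Real.rpow_def_of_pos ht0]
    nlinarith [Real.add_one_le_exp (Real.log t * (1 - R)), Real.log_le_sub_one_of_pos ht0]

/-- Tangent line bound for the CRRA utility at `a > 0`, where its slope is `a ^ (-R)`. -/
theorem rpow_one_sub_div_sub_mul_le {R a c : ℝ} (hR : 0 < R) (hR1 : R ≠ 1) (ha : 0 < a)
    (hc : 0 ≤ c) (hcR : 1 < R → c ≠ 0) :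
    c ^ (1 - R) / (1 - R) ≤ c * a ^ (-R) + a ^ (-R) * a * (R / (1 - R)) := by
  have h := rpow_one_sub_div_sub_le hR hR1 (div_nonneg hc ha.le)
    fun h1 => div_ne_zero (hcR h1) ha.ne'
  have hpow : a ^ (1 - R) = a ^ (-R) * a := by
    rw [sub_eq_neg_add, Real.rpow_add_one ha.ne']
  have hm : 0 < a ^ (-R) * a := mul_pos (Real.rpow_pos_of_pos ha _) ha
  have hsplit : c ^ (1 - R) = a ^ (-R) * a * (c / a) ^ (1 - R) := by
    rw [Real.div_rpow hc ha.le, hpow, mul_div_cancel₀ _ hm.ne']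
  calc c ^ (1 - R) / (1 - R) = a ^ (-R) * a * ((c / a) ^ (1 - R) / (1 - R)) := by
        rw [hsplit]; ring
    _ ≤ a ^ (-R) * a * (c / a + R / (1 - R)) := mul_le_mul_of_nonneg_left h hm.le
    _ = c * a ^ (-R) + a ^ (-R) * a * (R / (1 - R)) := by field_simp


/-- For the shifted candidate value function `V̂^ζ(x) = V̂(x+ζ)`,
`sup_{π ∈ ℝ, c ≥ 0} L(π, c; x, V̂^ζ) = −rζη^{−R}(x+ζ)^{−R}`; in particular if `r ≥ 0` then
`L(π, c; x, V̂^ζ) ≤ 0` for all `π ∈ ℝ`, `c ≥ 0`.  (Convention `0^{1−R} = ∞` for `R > 1`, so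
`L` is `EReal`-valued.) -/
theorem merton_shifted_HJB
    (r μ δ σ R : ℝ) (hσ : 0 < σ) (hR : 0 < R) (hR1 : R ≠ 1)
    (lam : ℝ) (hlam : lam = (μ - r) / σ)
    (η : ℝ) (hηdef : η = (1 / R) * (δ - (1 - R) * (r + lam ^ 2 / (2 * R))))
    (hη : 0 < η)
    (ζ : ℝ) (hζ : 0 < ζ)
    (x : ℝ) (hx : 0 < x)
    (L : ℝ → ℝ → EReal)
    (hL : ∀ p c : ℝ, L p c
      = (if c = 0 ∧ 1 < R then (⊥ : EReal) else ((c ^ (1 - R) / (1 - R) : ℝ) : EReal))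
        + (((-δ) * (η ^ (-R) * (x + ζ) ^ (1 - R) / (1 - R))
            + (x * (r + σ * lam * p) - c) * (η ^ (-R) * (x + ζ) ^ (-R))
            + (1 / 2) * σ ^ 2 * p ^ 2 * x ^ 2 * (-(R * η ^ (-R) * (x + ζ) ^ (-R - 1))) : ℝ)
          : EReal)) :
    sSup {w : EReal | ∃ p c : ℝ, 0 ≤ c ∧ w = L p c}
        = ((-(r * ζ * η ^ (-R) * (x + ζ) ^ (-R)) : ℝ) : EReal) ∧
      (0 ≤ r → ∀ p c : ℝ, 0 ≤ c → L p c ≤ (0 : EReal)) := by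
  have hy : 0 < x + ζ := by linarith
  have h1R : 1 - R ≠ 0 := sub_ne_zero.mpr hR1.symm
  have ha : 0 < η * (x + ζ) := mul_pos hη hy
  have hm : (η * (x + ζ)) ^ (-R) = η ^ (-R) * (x + ζ) ^ (-R) := Real.mul_rpow hη.le hy.le
  have hpow : (x + ζ) ^ (1 - R) = (x + ζ) ^ (-R) * (x + ζ) := by
    rw [sub_eq_neg_add, Real.rpow_add_one hy.ne']
  have hpow' : (x + ζ) ^ (-R - 1) = (x + ζ) ^ (-R) / (x + ζ) := Real.rpow_sub_one hy.ne' _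
  have hδ : δ = R * η + (1 - R) * (r + lam ^ 2 / (2 * R)) := by
    rw [hηdef]; field_simp; ring
  have hmpos : 0 < η ^ (-R) * (x + ζ) ^ (-R) :=
    mul_pos (Real.rpow_pos_of_pos hη _) (Real.rpow_pos_of_pos hy _)
  -- completing the square in the portfolio variable
  have hsq : ∀ p c : ℝ, (-δ) * (η ^ (-R) * (x + ζ) ^ (1 - R) / (1 - R))
      + (x * (r + σ * lam * p) - c) * (η ^ (-R) * (x + ζ) ^ (-R))
      + (1 / 2) * σ ^ 2 * p ^ 2 * x ^ 2 * (-(R * η ^ (-R) * (x + ζ) ^ (-R - 1)))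
      = -(r * ζ * η ^ (-R) * (x + ζ) ^ (-R))
        - (c * (η * (x + ζ)) ^ (-R) + (η * (x + ζ)) ^ (-R) * (η * (x + ζ)) * (R / (1 - R)))
        - η ^ (-R) * (x + ζ) ^ (-R) * (R / (2 * (x + ζ)))
          * (σ * p * x - lam * (x + ζ) / R) ^ 2 := by
    intro p c
    rw [hm, hpow, hpow', hδ]
    generalize η ^ (-R) = E
    generalize (x + ζ) ^ (-R) = A
    field_simp
    ring
  have hle : ∀ p c : ℝ, 0 ≤ c →
      L p c ≤ ((-(r * ζ * η ^ (-R) * (x + ζ) ^ (-R)) : ℝ) : EReal) := by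
    intro p c hc
    rw [hL]
    split_ifs with h
    · simp
    · rw [← EReal.coe_add, EReal.coe_le_coe_iff, hsq]
      have hu := rpow_one_sub_div_sub_mul_le hR hR1 ha hc fun h1 h0 => h ⟨h0, h1⟩
      have hq : 0 ≤ η ^ (-R) * (x + ζ) ^ (-R) * (R / (2 * (x + ζ)))
          * (σ * p * x - lam * (x + ζ) / R) ^ 2 := by positivity
      linarith
  have hmax : ((-(r * ζ * η ^ (-R) * (x + ζ) ^ (-R)) : ℝ) : EReal)
      = L (lam * (x + ζ) / (R * σ * x)) (η * (x + ζ)) := by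
    rw [hL, if_neg fun h => ha.ne' h.1, ← EReal.coe_add, EReal.coe_eq_coe_iff, hsq]
    have h0 : σ * (lam * (x + ζ) / (R * σ * x)) * x - lam * (x + ζ) / R = 0 := by
      field_simp
      ring
    have ha1 : (η * (x + ζ)) ^ (1 - R) = (η * (x + ζ)) ^ (-R) * (η * (x + ζ)) := by
      rw [sub_eq_neg_add, Real.rpow_add_one ha.ne']
    rw [h0, ha1]
    generalize (η * (x + ζ)) ^ (-R) = M
    field_simp
    ring
  refine ⟨le_antisymm (sSup_le ?_) (le_sSup ⟨_, _, ha.le, hmax⟩), fun hr p c hc => ?_⟩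
  · rintro w ⟨p, c, hc, rfl⟩
    exact hle p c hc
  · refine (hle p c hc).trans ?_
    rw [← EReal.coe_zero, EReal.coe_le_coe_iff, neg_nonpos]
    positivity
end
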